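/- Let P̄ be an uniplicit Markov kernel on a finite set V̄ with H(P̄) ≠ ∅. Let π : V̄ → V be a surjective map onto a finite set V, let Λ be the deterministic kernel Λ(x̄,·) = δ_{π(x̄)}, and let P be a Markov kernel on V satisfying the intertwining relation P̄Λ = ΛP. Then P is uniplicit, H(P) ≠ ∅, and P satisfies the hypergroup property with respect to some point of V. -/

import Mathlib

open scoped BigOperators

/-- A Markov kernel on a finite set `V`: nonnegative entries, row sums equal to 1. -/
def IsMarkov {V : Type*} [Fintype V] (P : Matrix V V ℝ) : Prop :=
  (∀ x y, 0 ≤ P x y) ∧ ∀ x, ∑ y, P x y = 1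

/-- Irreducibility: all entries of `∑_{n=1}^{|V|} P^n` are positive. -/
def IsIrreducibleKernel {V : Type*} [Fintype V] [DecidableEq V] (P : Matrix V V ℝ) : Prop :=
  ∀ x y, 0 < ∑ n ∈ Finset.Icc 1 (Fintype.card V), (P ^ n) x y

/-- A probability measure on `V`, seen as a nonnegative vector of total mass 1. -/
def IsProbVec {V : Type*} [Fintype V] (m : V → ℝ) : Prop :=
  (∀ x, 0 ≤ m x) ∧ ∑ x, m x = 1

/-- A probability measure positive on all points of `V`. -/
def IsPositiveProb {V : Type*} [Fintype V] (μ : V → ℝ) : Prop :=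
  (∀ x, 0 < μ x) ∧ ∑ x, μ x = 1

/-- Reversibility of `P` with respect to `μ`. -/
def IsReversible {V : Type*} (P : Matrix V V ℝ) (μ : V → ℝ) : Prop :=
  ∀ x y, μ x * P x y = μ y * P y x

/-- `P` is uniplicit: reversible with respect to some positive probability, and all its
eigenvalues have multiplicity 1 (every eigenspace has dimension at most one). -/
def Uniplicit {V : Type*} [Fintype V] (P : Matrix V V ℝ) : Prop :=
  (∃ μ : V → ℝ, IsPositiveProb μ ∧ IsReversible P μ) ∧
  ∀ (θ : ℝ) (f g : V → ℝ), P.mulVec f = θ • f → P.mulVec g = θ • g →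
    ∃ a b : ℝ, (a ≠ 0 ∨ b ≠ 0) ∧ a • f = b • g

/-- The Markov commutator of `P`: the Markov kernels commuting with `P`. -/
def MarkovCommutator {V : Type*} [Fintype V] (P : Matrix V V ℝ) : Set (Matrix V V ℝ) :=
  {K | IsMarkov K ∧ K * P = P * K}

/-- `K(P,x)`: the set of rows at `x` of elements of the Markov commutator of `P`. -/
def commRows {V : Type*} [Fintype V] (P : Matrix V V ℝ) (x : V) : Set (V → ℝ) :=
  {m | ∃ K ∈ MarkovCommutator P, m = fun y => K x y}

/-- `H(P) := {x : K(P,x) = P(V)}`. -/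
def HSet {V : Type*} [Fintype V] (P : Matrix V V ℝ) : Set V :=
  {x | commRows P x = {m | IsProbVec m}}

/-- The hypergroup property of `P` with respect to `μ` and the point `x0`. -/
def HypergroupProperty {V : Type*} [Fintype V]
    (P : Matrix V V ℝ) (μ : V → ℝ) (x0 : V) : Prop :=
  ∃ φ : Fin (Fintype.card V) → V → ℝ,
    (∃ k1, ∀ x, φ k1 x = 1) ∧
    (∀ k l, ∑ x, μ x * φ k x * φ l x = if k = l then 1 else 0) ∧
    (∀ k, ∃ θ : ℝ, ∀ x, ∑ y, P x y * φ k y = θ * φ k x) ∧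
    (∀ k, φ k x0 ≠ 0) ∧
    ∀ x y z, 0 ≤ ∑ k, φ k x * φ k y * φ k z / φ k x0

/-- `g` is a symmetry of `P`. -/
def IsSymmetry {V : Type*} (P : Matrix V V ℝ) (g : Equiv.Perm V) : Prop :=
  ∀ x y, P (g x) (g y) = P x y


/-- A Markov kernel from a finite set `V̄` to a finite set `V`. -/
def IsMarkovRect {Vb V : Type*} [Fintype V] (Λ : Matrix Vb V ℝ) : Prop :=
  (∀ xb y, 0 ≤ Λ xb y) ∧ ∀ xb, ∑ y, Λ xb y = 1

/-- The dual kernel `Λ*` of `Λ`, with respect to `μ̄` on `V̄` and `μ = μ̄Λ` on `V`: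
`Λ*(x,x̄) = μ̄(x̄)Λ(x̄,x)/μ(x)`. -/
noncomputable def dualKernel {Vb V : Type*} (μb : Vb → ℝ) (μ : V → ℝ)
    (Λ : Matrix Vb V ℝ) : Matrix V Vb ℝ :=
  Matrix.of fun x xb => μb xb * Λ xb x / μ x

/-- A kernel reversible with respect to `μ` is diagonalizable in an orthonormal basis of
`L²(μ)`. -/
theorem IsReversible.exists_eigenbasis {V : Type*} [Fintype V]
    {P : Matrix V V ℝ} {μ : V → ℝ} (hμ : IsPositiveProb μ) (hrev : IsReversible P μ) :
    ∃ (φ : Fin (Fintype.card V) → V → ℝ) (θ : Fin (Fintype.card V) → ℝ),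
      (∀ k l, ∑ x, μ x * φ k x * φ l x = if k = l then 1 else 0) ∧
      (∀ f : V → ℝ, f = ∑ k, (∑ z, μ z * φ k z * f z) • φ k) ∧
      ∀ k, P.mulVec (φ k) = θ k • φ k := by
  classical
  have hs : ∀ x, √(μ x) ≠ 0 := fun x => (Real.sqrt_pos.2 (hμ.1 x)).ne'
  have hss : ∀ x, √(μ x) * √(μ x) = μ x := fun x => Real.mul_self_sqrt (hμ.1 x).le
  let A : Matrix V V ℝ := Matrix.of fun x y => √(μ x) * P x y / √(μ y)
  have hA : A.IsHermitian := by
    ext x y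
    simp only [A, Matrix.conjTranspose_apply, Matrix.of_apply, star_trivial]
    rw [div_eq_div_iff (hs x) (hs y)]
    linear_combination P y x * hss y - P x y * hss x - hrev x y
  let e := (Fintype.equivFin V).symm
  let v : Fin (Fintype.card V) → V → ℝ := fun k => hA.eigenvectorBasis (e k)
  have hv : ∀ k l, ∑ x, v k x * v l x = if k = l then 1 else 0 := by
    intro k l
    have h := orthonormal_iff_ite.1 hA.eigenvectorBasis.orthonormal (e l) (e k)
    simp only [PiLp.inner_apply, RCLike.inner_apply, conj_trivial, e.injective.eq_iff] at h
    simpa only [eq_comm] using h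
  have hv' : ∀ x y, ∑ k, v k x * v k y = if x = y then 1 else 0 := by
    let M : Matrix V V ℝ := Matrix.of fun i x => v (e.symm i) x
    have hM : M * M.transpose = 1 := by
      ext i j
      simp [M, Matrix.mul_apply, hv, Matrix.one_apply]
    intro x y
    have h' : M.transpose * M = 1 := mul_eq_one_comm.1 hM
    have h := congrFun (congrFun h' x) y
    rw [Matrix.mul_apply, Matrix.one_apply, ← e.sum_comp] at h
    simpa [M] using h
  refine ⟨fun k x => v k x / √(μ x), fun k => hA.eigenvalues (e k), ?_, ?_, ?_⟩
  · intro k l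
    rw [← hv]
    refine Finset.sum_congr rfl fun x _ => ?_
    have := hs x
    field_simp
    rw [Real.sq_sqrt (hμ.1 x).le]
    ring
  · intro f
    ext x
    simp only [Finset.sum_apply, Pi.smul_apply, smul_eq_mul, Finset.sum_mul]
    rw [Finset.sum_comm]
    have h : ∀ z, ∑ k, μ z * (v k z / √(μ z)) * f z * (v k x / √(μ x)) =
        if z = x then f x else 0 := by
      intro z
      have h1 : ∀ k, μ z * (v k z / √(μ z)) * f z * (v k x / √(μ x)) =
          √(μ z) * f z / √(μ x) * (v k z * v k x) := by
        intro k
        have := hs x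
        have := hs z
        field_simp
        rw [Real.sq_sqrt (hμ.1 z).le]
        ring
      simp only [h1, ← Finset.mul_sum, hv']
      split_ifs with hzx
      · subst hzx
        have := hs z
        field_simp
      · simp
    simp [h]
  · intro k
    ext x
    have h := congrFun (hA.mulVec_eigenvectorBasis (e k)) x
    simp only [Matrix.mulVec, dotProduct, A, Matrix.of_apply, Pi.smul_apply, smul_eq_mul] at h ⊢
    have := hs x
    rw [← mul_div_assoc, eq_div_iff this, ← h, Finset.sum_mul]
    refine Finset.sum_congr rfl fun y _ => ?_
    have := hs y
    field_simp
    rfl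

/-- Matrices commuting with an uniplicit kernel preserve its eigenlines. -/
theorem Uniplicit.exists_mulVec_eq_smul {V : Type*} [Fintype V] {P K : Matrix V V ℝ}
    (hP : Uniplicit P) (hK : K * P = P * K) {θ : ℝ} {f : V → ℝ} (hf : f ≠ 0)
    (hPf : P.mulVec f = θ • f) : ∃ c : ℝ, K.mulVec f = c • f := by
  have hKf : P.mulVec (K.mulVec f) = θ • K.mulVec f := by
    rw [Matrix.mulVec_mulVec, ← hK, ← Matrix.mulVec_mulVec, hPf, Matrix.mulVec_smul]
  obtain ⟨a, b, hab, h⟩ := hP.2 θ f _ hPf hKf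
  by_cases hb : b = 0
  · subst hb
    simp_all
  · exact ⟨b⁻¹ * a, by rw [mul_smul, h, inv_smul_smul₀ hb]⟩

theorem IsReversible.sum_mul_mulVec {V : Type*} [Fintype V] {P : Matrix V V ℝ} {μ : V → ℝ}
    (hP : IsMarkov P) (hrev : IsReversible P μ) (f : V → ℝ) :
    ∑ x, μ x * P.mulVec f x = ∑ x, μ x * f x := by
  simp only [Matrix.mulVec, dotProduct, Finset.mul_sum]
  rw [Finset.sum_comm]
  refine Finset.sum_congr rfl fun y _ => ?_
  simp only [← mul_assoc, hrev _ y]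
  rw [← Finset.sum_mul, ← Finset.mul_sum, hP.2, mul_one]

/-- An uniplicit kernel has an orthonormal eigenbasis containing the constant function `1`. -/
theorem Uniplicit.exists_eigenbasis_one {V : Type*} [Fintype V] {P : Matrix V V ℝ} {μ : V → ℝ}
    (hP : IsMarkov P) (hU : Uniplicit P) (hμ : IsPositiveProb μ) (hrev : IsReversible P μ) :
    ∃ (φ : Fin (Fintype.card V) → V → ℝ) (θ : Fin (Fintype.card V) → ℝ),
      (∃ k, ∀ x, φ k x = 1) ∧
      (∀ k l, ∑ x, μ x * φ k x * φ l x = if k = l then 1 else 0) ∧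
      (∀ f : V → ℝ, f = ∑ k, (∑ z, μ z * φ k z * f z) • φ k) ∧
      ∀ k, P.mulVec (φ k) = θ k • φ k := by
  obtain ⟨φ, θ, hort, hexp, heig⟩ := hrev.exists_eigenbasis hμ
  have hV : Nonempty V := by
    by_contra h
    rw [not_nonempty_iff] at h
    simpa using hμ.2
  obtain ⟨k, hk⟩ : ∃ k, ∑ z, μ z * φ k z ≠ 0 := by
    by_contra! h
    have := congrFun (hexp 1) hV.some
    simp [h] at this
  have hθ : θ k = 1 := by
    have h := hrev.sum_mul_mulVec hP (φ k)
    simp only [heig, Pi.smul_apply, smul_eq_mul, mul_left_comm _ (θ k)] at h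
    rw [← Finset.mul_sum] at h
    exact mul_right_cancel₀ hk (by rw [h, one_mul])
  have hone : P.mulVec (1 : V → ℝ) = (1 : ℝ) • 1 := by
    ext x
    simp [Matrix.mulVec, dotProduct, hP.2]
  obtain ⟨a, b, hab, h⟩ := hU.2 1 1 (φ k) hone (hθ ▸ heig k)
  have hb : b ≠ 0 := by
    rintro rfl
    exact hab.elim (fun ha => ha (by simpa using congrFun h hV.some)) (fun hb => hb rfl)
  have hc : ∀ x, φ k x = b⁻¹ * a := by
    intro x
    have := congrFun h x
    simp only [Pi.smul_apply, smul_eq_mul, Pi.one_apply, mul_one] at this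
    rw [this, inv_mul_cancel_left₀ hb]
  generalize b⁻¹ * a = c at hc
  have hcc : c * c = 1 := by
    have h := hort k k
    simp only [hc, if_true, mul_assoc] at h
    rwa [← Finset.sum_mul, hμ.2, one_mul] at h
  refine ⟨fun k => c • φ k, θ, ⟨k, fun x => by simp [hc, hcc]⟩, ?_, ?_, ?_⟩
  · intro k l
    rw [← hort]
    refine Finset.sum_congr rfl fun x _ => ?_
    simp only [Pi.smul_apply, smul_eq_mul]
    linear_combination μ x * φ k x * φ l x * hcc
  · intro f
    conv_lhs => rw [hexp f]
    refine Finset.sum_congr rfl fun k _ => ?_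
    rw [smul_smul, Finset.sum_mul]
    congr 1
    refine Finset.sum_congr rfl fun x _ => ?_
    simp only [Pi.smul_apply, smul_eq_mul]
    linear_combination -(μ x * φ k x * f x * hcc)
  · intro k
    rw [Matrix.mulVec_smul, heig, smul_comm]

/-- An uniplicit kernel satisfies the hypergroup property with respect to every point of
`H(P)`. -/
theorem Uniplicit.hypergroupProperty {V : Type*} [Fintype V] {P : Matrix V V ℝ} {μ : V → ℝ}
    (hP : IsMarkov P) (hU : Uniplicit P) (hμ : IsPositiveProb μ) (hrev : IsReversible P μ)
    {x0 : V} (hx0 : x0 ∈ HSet P) : HypergroupProperty P μ x0 := by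
  classical
  obtain ⟨φ, θ, hone, hort, hexp, heig⟩ := hU.exists_eigenbasis_one hP hμ hrev
  have hne : ∀ k, φ k ≠ 0 := by
    intro k h
    simpa [h] using hort k k
  have hK : ∀ y, ∃ K ∈ MarkovCommutator P, Pi.single y 1 = fun z => K x0 z := by
    intro y
    have : (Pi.single y 1 : V → ℝ) ∈ commRows P x0 := by
      rw [show commRows P x0 = _ from hx0]
      refine ⟨fun x => ?_, by simp⟩
      rw [Pi.single_apply]
      split_ifs <;> norm_num
    exact this
  choose K hKc hK0 using hK
  have hc : ∀ y k, ∃ c : ℝ, (K y).mulVec (φ k) = c • φ k := fun y k =>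
    hU.exists_mulVec_eq_smul (hKc y).2 (hne k) (heig k)
  choose c hc using hc
  have hcx : ∀ y k, φ k y = c y k * φ k x0 := by
    intro y k
    have h := congrFun (hc y k) x0
    simp only [Matrix.mulVec, ← hK0] at h
    simpa using h
  have hφ0 : ∀ k, φ k x0 ≠ 0 := by
    intro k h
    exact hne k (funext fun y => by rw [hcx, h, mul_zero, Pi.zero_apply])
  refine ⟨φ, hone, hort, fun k => ⟨θ k, fun x => congrFun (heig k) x⟩, hφ0, fun x y z => ?_⟩
  have h := congrFun (congrArg (K y).mulVec (hexp (Pi.single z 1))) x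
  rw [Matrix.mulVec_sum] at h
  simp only [Matrix.mulVec_smul, hc, Finset.sum_apply, Pi.smul_apply, smul_eq_mul,
    Matrix.mulVec_single_one, Matrix.col_apply, Pi.single_apply, mul_ite, mul_one, mul_zero,
    Finset.sum_ite_eq', Finset.mem_univ, if_true] at h
  have hs : K y x z = μ z * ∑ k, φ k x * φ k y * φ k z / φ k x0 := by
    rw [h, Finset.mul_sum]
    refine Finset.sum_congr rfl fun k _ => ?_
    rw [hcx y k]
    have := hφ0 k
    field_simp
  exact nonneg_of_mul_nonneg_right (hs ▸ (hKc y).1.1 x z) (hμ.1 z)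

section Quotient

variable {Vb V : Type*} [Fintype V] [DecidableEq V]
  {Pb : Matrix Vb Vb ℝ} {P : Matrix V V ℝ} {π : Vb → V} {Λ : Matrix Vb V ℝ}

theorem deterministicLink_mul_apply (hΛ : ∀ xb y, Λ xb y = if y = π xb then 1 else 0)
    {W : Type*} (M : Matrix V W ℝ) (xb : Vb) (w : W) : (Λ * M) xb w = M (π xb) w := by
  simp [Matrix.mul_apply, hΛ]

theorem deterministicLink_mulVec (hΛ : ∀ xb y, Λ xb y = if y = π xb then 1 else 0)
    (f : V → ℝ) : Λ.mulVec f = f ∘ π := by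
  ext x
  simp [Matrix.mulVec, dotProduct, hΛ]

variable [Fintype Vb]

theorem mulVec_comp_of_intertwining (hΛ : ∀ xb y, Λ xb y = if y = π xb then 1 else 0)
    (hint : Pb * Λ = Λ * P) (f : V → ℝ) : Pb.mulVec (f ∘ π) = P.mulVec f ∘ π := by
  rw [← deterministicLink_mulVec hΛ, Matrix.mulVec_mulVec, hint, ← Matrix.mulVec_mulVec,
    deterministicLink_mulVec hΛ]

/-- The image of `μ̄` under `π`. -/
theorem IsPositiveProb.pushforward {μb : Vb → ℝ} (hμb : IsPositiveProb μb)
    (hΛ : ∀ xb y, Λ xb y = if y = π xb then 1 else 0) (hπ : Function.Surjective π) :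
    IsPositiveProb (Matrix.vecMul μb Λ) := by
  constructor
  · intro y
    obtain ⟨x, rfl⟩ := hπ y
    refine Finset.sum_pos' (fun z _ => ?_) ⟨x, Finset.mem_univ _, by simp [hΛ, hμb.1 x]⟩
    refine mul_nonneg (hμb.1 z).le ?_
    simp only [hΛ]
    split_ifs <;> norm_num
  · simp only [Matrix.vecMul, dotProduct]
    rw [Finset.sum_comm]
    simp [hΛ, hμb.2]

theorem IsReversible.pushforward {μb : Vb → ℝ} (hrev : IsReversible Pb μb)
    (hΛ : ∀ xb y, Λ xb y = if y = π xb then 1 else 0) (hint : Pb * Λ = Λ * P) :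
    IsReversible P (Matrix.vecMul μb Λ) := by
  have key : ∀ y z, Matrix.vecMul μb Λ y * P y z =
      ∑ a, ∑ b, μb a * Pb a b * (Λ a y * Λ b z) := by
    intro y z
    simp only [Matrix.vecMul, dotProduct, Finset.sum_mul]
    refine Finset.sum_congr rfl fun a _ => ?_
    have h := congrFun (congrFun hint a) z
    rw [deterministicLink_mul_apply hΛ, Matrix.mul_apply] at h
    have h' : Λ a y * P y z = Λ a y * ∑ b, Pb a b * Λ b z := by
      rw [h, hΛ]
      split_ifs with hy
      · rw [hy]
      · simp
    rw [mul_assoc, h', Finset.mul_sum, Finset.mul_sum]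
    exact Finset.sum_congr rfl fun b _ => by ring
  intro y z
  rw [key, key, Finset.sum_comm]
  refine Finset.sum_congr rfl fun a _ => Finset.sum_congr rfl fun b _ => ?_
  rw [hrev b a, mul_comm (Λ b y)]

theorem Uniplicit.of_intertwining (hU : Uniplicit Pb) (hπ : Function.Surjective π)
    (hΛ : ∀ xb y, Λ xb y = if y = π xb then 1 else 0) (hint : Pb * Λ = Λ * P) :
    Uniplicit P := by
  obtain ⟨⟨μb, hμb, hrev⟩, hmul⟩ := hU
  refine ⟨⟨_, hμb.pushforward hΛ hπ, hrev.pushforward hΛ hint⟩, fun θ f g hf hg => ?_⟩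
  obtain ⟨a, b, hab, h⟩ := hmul θ (f ∘ π) (g ∘ π)
    (by rw [mulVec_comp_of_intertwining hΛ hint, hf]; rfl)
    (by rw [mulVec_comp_of_intertwining hΛ hint, hg]; rfl)
  exact ⟨a, b, hab, hπ.injective_comp_right h⟩

/-- A matrix commuting with `P̄` preserves the functions which factor through `π`. -/
theorem Uniplicit.exists_mulVec_comp (hU : Uniplicit Pb) (hπ : Function.Surjective π)
    (hΛ : ∀ xb y, Λ xb y = if y = π xb then 1 else 0) (hint : Pb * Λ = Λ * P)
    {Kb : Matrix Vb Vb ℝ} (hKb : Kb * Pb = Pb * Kb) (f : V → ℝ) :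
    ∃ g : V → ℝ, Kb.mulVec (f ∘ π) = g ∘ π := by
  obtain ⟨μ, hμ, hrev⟩ := (hU.of_intertwining hπ hΛ hint).1
  obtain ⟨φ, θ, hort, hexp, heig⟩ := hrev.exists_eigenbasis hμ
  have hc : ∀ k, ∃ c : ℝ, Kb.mulVec (φ k ∘ π) = c • (φ k ∘ π) := by
    intro k
    refine hU.exists_mulVec_eq_smul hKb (θ := θ k) (fun h => ?_) ?_
    · have h0 : φ k = 0 := hπ.injective_comp_right h
      simpa [h0] using hort k k
    · rw [mulVec_comp_of_intertwining hΛ hint, heig]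
      rfl
  choose c hc using hc
  refine ⟨∑ k, (∑ z, μ z * φ k z * f z) • c k • φ k, ?_⟩
  have hsum : f ∘ π = ∑ k, (∑ z, μ z * φ k z * f z) • (φ k ∘ π) := by
    ext x
    have := congrFun (hexp f) (π x)
    simpa only [Finset.sum_apply, Pi.smul_apply, Function.comp_apply] using this
  rw [hsum, Matrix.mulVec_sum]
  ext x
  simp [Matrix.mulVec_smul, hc]

/-- The Markov commutator of `P̄` projects to the Markov commutator of `P`. -/
theorem Uniplicit.exists_markovCommutator_quotient (hU : Uniplicit Pb)
    (hπ : Function.Surjective π) (hΛ : ∀ xb y, Λ xb y = if y = π xb then 1 else 0)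
    (hint : Pb * Λ = Λ * P) {Kb : Matrix Vb Vb ℝ} (hKb : Kb ∈ MarkovCommutator Pb) :
    ∃ K ∈ MarkovCommutator P, Kb * Λ = Λ * K := by
  obtain ⟨⟨hnn, hsum⟩, hcomm⟩ := hKb
  choose g hg using fun y =>
    hU.exists_mulVec_comp hπ hΛ hint hcomm (fun z : V => if y = z then 1 else 0)
  obtain ⟨K, hKΛ⟩ : ∃ K : Matrix V V ℝ, Kb * Λ = Λ * K := by
    refine ⟨Matrix.of fun x y => g y x, ?_⟩
    ext x y
    rw [deterministicLink_mul_apply hΛ]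
    have := congrFun (hg y) x
    simp only [Function.comp_apply] at this
    rw [Matrix.of_apply, ← this]
    simp [Matrix.mul_apply, Matrix.mulVec, dotProduct, hΛ]
  have hK : ∀ x y, K (π x) y = ∑ z, Kb x z * Λ z y := fun x y => by
    rw [← deterministicLink_mul_apply hΛ K, ← hKΛ, Matrix.mul_apply]
  refine ⟨K, ⟨⟨fun x y => ?_, fun x => ?_⟩, ?_⟩, hKΛ⟩
  · obtain ⟨x, rfl⟩ := hπ x
    rw [hK]
    refine Finset.sum_nonneg fun z _ => mul_nonneg (hnn _ _) ?_
    rw [hΛ]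
    split_ifs <;> norm_num
  · obtain ⟨x, rfl⟩ := hπ x
    simp only [hK]
    rw [Finset.sum_comm]
    simp [hΛ, hsum]
  · have h : Λ * (K * P) = Λ * (P * K) := by
      rw [← Matrix.mul_assoc, ← hKΛ, Matrix.mul_assoc, ← hint, ← Matrix.mul_assoc, hcomm,
        Matrix.mul_assoc, hKΛ, ← Matrix.mul_assoc, hint, Matrix.mul_assoc]
    ext x y
    obtain ⟨x, rfl⟩ := hπ x
    rw [← deterministicLink_mul_apply hΛ (K * P), h, deterministicLink_mul_apply hΛ]

theorem Uniplicit.map_mem_hSet (hU : Uniplicit Pb)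
    (hπ : Function.Surjective π) (hΛ : ∀ xb y, Λ xb y = if y = π xb then 1 else 0)
    (hint : Pb * Λ = Λ * P) {xb : Vb} (hxb : xb ∈ HSet Pb) : π xb ∈ HSet P := by
  refine Set.Subset.antisymm ?_ fun m hm => ?_
  · rintro _ ⟨K, hK, rfl⟩
    exact ⟨hK.1.1 _, hK.1.2 _⟩
  classical
  obtain ⟨s, hs⟩ := hπ.hasRightInverse
  let mb : Vb → ℝ := fun x => ∑ y, if s y = x then m y else 0
  have hmb : mb ∈ commRows Pb xb := by
    rw [show commRows Pb xb = _ from hxb]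
    refine ⟨fun x => Finset.sum_nonneg fun y _ => ?_, ?_⟩
    · split_ifs
      exacts [hm.1 y, le_rfl]
    · simp only [mb]
      rw [Finset.sum_comm]
      simpa using hm.2
  obtain ⟨Kb, hKb, hrow⟩ := hmb
  obtain ⟨K, hK, hKΛ⟩ := hU.exists_markovCommutator_quotient hπ hΛ hint hKb
  refine ⟨K, hK, funext fun y => ?_⟩
  rw [← deterministicLink_mul_apply hΛ K, ← hKΛ, Matrix.mul_apply]
  have : ∀ x, Kb xb x = mb x := fun x => (congrFun hrow x).symm
  simp only [this, mb, Finset.sum_mul]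
  rw [Finset.sum_comm]
  simp only [ite_mul, zero_mul, Finset.sum_ite_eq, Finset.mem_univ, if_true, hΛ, hs _]
  simp

end Quotient

/-- If `P̄` is uniplicit with `H(P̄) ≠ ∅`, `π : V̄ → V` is surjective,
`Λ` is the deterministic link `Λ(x̄,·) = δ_{π(x̄)}`, and `P` is a Markov kernel on `V`
satisfying the intertwining `P̄Λ = ΛP`, then `P` is uniplicit, `H(P) ≠ ∅`, and `P`
satisfies the hypergroup property with respect to some point of `V`. -/
theorem intertwined_quotient_hypergroup
    {Vb V : Type*} [Fintype Vb] [DecidableEq Vb] [Fintype V] [DecidableEq V]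
    (Pb : Matrix Vb Vb ℝ) (hPbM : IsMarkov Pb) (hPbU : Uniplicit Pb)
    (hH : (HSet Pb).Nonempty)
    (π : Vb → V) (hπ : Function.Surjective π)
    (Λ : Matrix Vb V ℝ) (hΛ : ∀ xb y, Λ xb y = if y = π xb then 1 else 0)
    (P : Matrix V V ℝ) (hP : IsMarkov P) (hint : Pb * Λ = Λ * P) :
    Uniplicit P ∧ (HSet P).Nonempty ∧
    ∃ (x0 : V) (μ : V → ℝ), IsPositiveProb μ ∧ IsReversible P μ ∧
      HypergroupProperty P μ x0 := by
  have hU := hPbU.of_intertwining hπ hΛ hint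
  obtain ⟨xb, hxb⟩ := hH
  have hx := hPbU.map_mem_hSet hπ hΛ hint hxb
  obtain ⟨μ, hμ, hrev⟩ := hU.1
  exact ⟨hU, ⟨_, hx⟩, _, μ, hμ, hrev, hU.hypergroupProperty hP hμ hrev hx⟩
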